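/- Let E be a centrally orthocomplete pseudo-effect algebra and Q ⊆ E. Then: (i) [Q^γ] is the smallest type-determining subset of E containing Q; (ii) [Q↓] is the smallest strongly type-determining subset of E containing Q; (iii) Q' and Q'' are strongly type-determining subsets of E; (iv) Q' = [Q^γ]' = [Q↓]'. -/

import Mathlib

namespace PEApaper

/-- The bare data of a partial-addition structure: a partial binary operation
(encoded via `Option`) together with constants `0` and `1`. -/
structure PartialStruct (E : Type) where
  padd : E → E → Option E
  zero : E
  one : E

namespace PartialStruct

variable {E : Type}

/-- `a ≤ b` iff `a + c = b` for some `c`. -/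
def le (P : PartialStruct E) (a b : E) : Prop := ∃ c, P.padd a c = some b

/-- `m` is the greatest lower bound (meet `a ∧ b`) of `a` and `b`. -/
def IsMeet (P : PartialStruct E) (a b m : E) : Prop :=
  P.le m a ∧ P.le m b ∧ ∀ x, P.le x a → P.le x b → P.le x m

/-- `j` is the least upper bound (join `a ∨ b`) of `a` and `b`. -/
def IsJoin (P : PartialStruct E) (a b j : E) : Prop :=
  P.le a j ∧ P.le b j ∧ ∀ x, P.le a x → P.le b x → P.le j x

/-- `s` is the supremum of the set `S`. -/
def IsSup (P : PartialStruct E) (S : Set E) (s : E) : Prop :=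
  (∀ x ∈ S, P.le x s) ∧ ∀ u, (∀ x ∈ S, P.le x u) → P.le s u

/-- Left-associated partial sum of a list, continuing from `acc`. -/
def IsSumFrom (P : PartialStruct E) : E → List E → E → Prop
  | acc, [], s => s = acc
  | acc, a :: l, s => ∃ t, P.padd acc a = some t ∧ IsSumFrom P t l s

/-- `s` is the (left-associated) orthosum `e₁ + e₂ + ⋯ + eₙ` of the list. -/
def IsSumList (P : PartialStruct E) (l : List E) (s : E) : Prop :=
  match l with
  | [] => s = P.zero
  | a :: t => IsSumFrom P a t s

/-- `c` is a central element: there is a PEA-isomorphism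
`f : E → E[0,c] × E[0,c∼]` with `f c = (c,0)` such that `f x = (x₁,x₂)`
implies `x = x₁ + x₂`.  The isomorphism onto the product of the two
interval pseudo-effect algebras is spelled out explicitly. -/
def IsCentral (P : PartialStruct E) (c : E) : Prop :=
  ∃ cs, P.padd c cs = some P.one ∧
    ∃ f : E → E × E,
      (∀ x, P.le (f x).1 c ∧ P.le (f x).2 cs) ∧
      Function.Injective f ∧
      (∀ y : E × E, P.le y.1 c → P.le y.2 cs → ∃ x, f x = y) ∧
      f c = (c, P.zero) ∧
      f P.one = (c, cs) ∧
      (∀ x, P.padd (f x).1 (f x).2 = some x) ∧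
      (∀ a b ab, P.padd a b = some ab →
        P.padd (f a).1 (f b).1 = some (f ab).1 ∧
        P.padd (f a).2 (f b).2 = some (f ab).2) ∧
      (∀ a b s t, P.padd (f a).1 (f b).1 = some s → P.le s c →
        P.padd (f a).2 (f b).2 = some t → P.le t cs →
        ∃ ab, P.padd a b = some ab)

/-- The center `Γ(E)`. -/
def center (P : PartialStruct E) : Set E := {c | P.IsCentral c}

/-- The central interval `Γ(E)[0,c] = Γ(E) ∩ E[0,c]`. -/
def centerIntervalSet (P : PartialStruct E) (c : E) : Set E :=
  {x | P.IsCentral x ∧ P.le x c}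

/-- A Γ-orthogonal family: one dominated elementwise by a pairwise
disjoint family of central elements. -/
def GammaOrthogonal (P : PartialStruct E) {I : Type} (e : I → E) : Prop :=
  ∃ c : I → E, (∀ i, P.IsCentral (c i)) ∧
    (∀ i j, i ≠ j → P.IsMeet (c i) (c j) P.zero) ∧
    ∀ i, P.le (e i) (c i)

/-- Centrally orthocomplete: every Γ-orthogonal family has a supremum. -/
def IsCOPEA (P : PartialStruct E) : Prop :=
  ∀ (I : Type) (e : I → E), P.GammaOrthogonal e → ∃ s, P.IsSup (Set.range e) s

/-- `c` is the central cover of `e`: the smallest central element above `e`. -/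
def IsCentralCover (P : PartialStruct E) (c e : E) : Prop :=
  P.IsCentral c ∧ P.le e c ∧ ∀ d, P.IsCentral d → P.le e d → P.le c d

/-- `[Q]`: the set of all suprema of Γ-orthogonal families of elements of `Q`. -/
def bra (P : PartialStruct E) (Q : Set E) : Set E :=
  {s | ∃ (I : Type) (e : I → E), (∀ i, e i ∈ Q) ∧ P.GammaOrthogonal e ∧
    P.IsSup (Set.range e) s}

/-- `Q^γ = {q ∧ c : q ∈ Q, c ∈ Γ(E)}`. -/
def gammaClosure (P : PartialStruct E) (Q : Set E) : Set E :=
  {m | ∃ q ∈ Q, ∃ c, P.IsCentral c ∧ P.IsMeet q c m}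

/-- `Q↓ = ⋃_{q ∈ Q} E[0,q]`. -/
def downSet (P : PartialStruct E) (Q : Set E) : Set E :=
  {e | ∃ q ∈ Q, P.le e q}

/-- `Q' = {e ∈ E : q ∧ e = 0 for all q ∈ Q}`. -/
def commutant (P : PartialStruct E) (Q : Set E) : Set E :=
  {e | ∀ q ∈ Q, P.IsMeet q e P.zero}

/-- A type-determining (TD) set: `K = [K] = K^γ`. -/
def IsTD (P : PartialStruct E) (K : Set E) : Prop :=
  P.bra K = K ∧ P.gammaClosure K = K

/-- A strongly type-determining (STD) set: `K = [K] = K↓`. -/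
def IsSTD (P : PartialStruct E) (K : Set E) : Prop :=
  P.bra K = K ∧ P.downSet K = K

/-- `c` is the type-cover of `K` (w.r.t. the central cover map `γ`):
the unique central element with `γK = Γ(E)[0,c]`. -/
def IsTypeCover (P : PartialStruct E) (γ : E → E) (K : Set E) (c : E) : Prop :=
  P.IsCentral c ∧ γ '' K = P.centerIntervalSet c

/-- An atom: a nonzero element with no proper nonzero subelement. -/
def IsAtom' (P : PartialStruct E) (a : E) : Prop :=
  a ≠ P.zero ∧ ∀ x, P.le x a → x = P.zero ∨ x = a

end PartialStruct

/-- A PEA-isomorphism between two partial-addition structures: a bijective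
morphism whose inverse is a morphism. -/
structure IsPEAIso {A B : Type} (P : PartialStruct A) (Q : PartialStruct B)
    (f : A → B) : Prop where
  bijective : Function.Bijective f
  map_one : f P.one = Q.one
  map_add : ∀ a b ab, P.padd a b = some ab → Q.padd (f a) (f b) = some (f ab)
  rev_add : ∀ a b s, Q.padd (f a) (f b) = some s → ∃ ab, P.padd a b = some ab

open scoped Classical in
/-- The (coordinatewise) product of a family of partial structures. -/
noncomputable def prodStruct {I : Type} {A : I → Type}
    (Ps : ∀ i, PartialStruct (A i)) : PartialStruct (∀ i, A i) where
  padd a b :=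
    if h : ∀ i, ∃ s, (Ps i).padd (a i) (b i) = some s
    then some fun i => Classical.choose (h i)
    else none
  zero := fun i => (Ps i).zero
  one := fun i => (Ps i).one

/-- A pseudo-effect algebra. -/
structure PEA (E : Type) extends PartialStruct E where
  assoc_def : ∀ a b c : E,
    (∃ ab, padd a b = some ab ∧ ∃ x, padd ab c = some x) ↔
    (∃ bc, padd b c = some bc ∧ ∃ y, padd a bc = some y)
  assoc_eq : ∀ a b c ab bc x y, padd a b = some ab → padd ab c = some x →
    padd b c = some bc → padd a bc = some y → x = y
  exu_right : ∀ a : E, ∃! d, padd a d = some one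
  exu_left : ∀ a : E, ∃! e, padd e a = some one
  shift : ∀ a b ab, padd a b = some ab →
    (∃ d, padd d a = some ab) ∧ (∃ e, padd b e = some ab)
  one_add : ∀ a x, padd one a = some x → a = zero
  add_one : ∀ a x, padd a one = some x → a = zero

namespace PEA

variable {E : Type} (P : PEA E)

/-- Shorthand for the underlying partial structure. -/
abbrev ps : PartialStruct E := P.toPartialStruct

theorem one_add_zero : P.padd P.one P.zero = some P.one := by
  obtain ⟨d, hd, -⟩ := P.exu_right P.one
  have h := P.one_add d P.one hd
  rwa [h] at hd

theorem zero_add_one : P.padd P.zero P.one = some P.one := by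
  obtain ⟨e, he, -⟩ := P.exu_left P.one
  have h := P.add_one e P.one he
  rwa [h] at he

theorem padd_zero (a : E) : P.padd a P.zero = some a := by
  obtain ⟨e, he, -⟩ := P.exu_left a
  have h1 : ∃ ab, P.padd e a = some ab ∧ ∃ x, P.padd ab P.zero = some x :=
    ⟨P.one, he, P.one, P.one_add_zero⟩
  obtain ⟨t, ht, y, hy⟩ := (P.assoc_def e a P.zero).mp h1
  have hxy : P.one = y :=
    P.assoc_eq e a P.zero P.one t P.one y he P.one_add_zero ht hy
  obtain ⟨d, hd, hu⟩ := P.exu_right e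
  have hta : t = a := by
    have h2 : t = d := hu t (by rw [← hxy] at hy; exact hy)
    have h3 : a = d := hu a he
    rw [h2, h3]
  rwa [hta] at ht

theorem zero_padd (a : E) : P.padd P.zero a = some a := by
  obtain ⟨d, hd, -⟩ := P.exu_right a
  have h1 : ∃ bc, P.padd a d = some bc ∧ ∃ y, P.padd P.zero bc = some y :=
    ⟨P.one, hd, P.one, P.zero_add_one⟩
  obtain ⟨t, ht, y, hy⟩ := (P.assoc_def P.zero a d).mpr h1
  have hxy : y = P.one :=
    P.assoc_eq P.zero a d t P.one y P.one ht hy hd P.zero_add_one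
  obtain ⟨e, he, hu⟩ := P.exu_left d
  have hta : t = a := by
    have h2 : t = e := hu t (by rw [hxy] at hy; exact hy)
    have h3 : a = e := hu a hd
    rw [h2, h3]
  rwa [hta] at ht

theorem zero_le (a : E) : P.ps.le P.zero a := ⟨a, P.zero_padd a⟩

theorem le_refl (a : E) : P.ps.le a a := ⟨P.zero, P.padd_zero a⟩

open scoped Classical in
/-- The interval pseudo-effect algebra `E[0,p]` as a partial structure on
the subtype `{x // x ≤ p}`; the sum is defined iff it is defined in `E`
and lies below `p`, and the unit is `p`. -/
noncomputable def intervalStruct (p : E) :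
    PartialStruct {x : E // P.ps.le x p} where
  padd a b := (P.padd a.1 b.1).bind fun s =>
    if h : P.ps.le s p then some ⟨s, h⟩ else none
  zero := ⟨P.zero, P.zero_le p⟩
  one := ⟨p, P.le_refl p⟩

end PEA

/-- The order relation of a complete Boolean algebra structure, made explicit. -/
def cbaLe {X : Type} (inst : CompleteBooleanAlgebra X) (a b : X) : Prop :=
  @LE.le X (by letI := inst; exact inferInstance) a b

end PEApaper

namespace PEApaper

namespace PEA

variable {E : Type} {P : PEA E}

theorem assoc_right {a b c ab x : E} (h₁ : P.padd a b = some ab) (h₂ : P.padd ab c = some x) :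
    ∃ bc, P.padd b c = some bc ∧ P.padd a bc = some x := by
  obtain ⟨bc, hbc, y, hy⟩ := (P.assoc_def a b c).mp ⟨ab, h₁, x, h₂⟩
  exact ⟨bc, hbc, P.assoc_eq a b c ab bc x y h₁ h₂ hbc hy ▸ hy⟩

theorem assoc_left {a b c bc x : E} (h₁ : P.padd b c = some bc) (h₂ : P.padd a bc = some x) :
    ∃ ab, P.padd a b = some ab ∧ P.padd ab c = some x := by
  obtain ⟨ab, hab, y, hy⟩ := (P.assoc_def a b c).mpr ⟨bc, h₁, x, h₂⟩
  exact ⟨ab, hab, P.assoc_eq a b c ab bc y x hab hy h₁ h₂ ▸ hy⟩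

theorem padd_left_cancel {a b c s : E} (hb : P.padd a b = some s) (hc : P.padd a c = some s) :
    b = c := by
  obtain ⟨e, he, -⟩ := P.exu_left s
  obtain ⟨ea, h₁, h₂⟩ := assoc_left hb he
  obtain ⟨ea', h₃, h₄⟩ := assoc_left hc he
  obtain rfl : ea = ea' := Option.some.inj (h₁.symm.trans h₃)
  exact (P.exu_right ea).unique h₂ h₄

theorem padd_right_cancel {a b c s : E} (ha : P.padd a c = some s) (hb : P.padd b c = some s) :
    a = b := by
  obtain ⟨d, hd, -⟩ := P.exu_right s
  obtain ⟨cd, h₁, h₂⟩ := assoc_right ha hd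
  obtain ⟨cd', h₃, h₄⟩ := assoc_right hb hd
  obtain rfl : cd = cd' := Option.some.inj (h₁.symm.trans h₃)
  exact (P.exu_left cd).unique h₂ h₄

theorem le_trans {a b c : E} (hab : P.ps.le a b) (hbc : P.ps.le b c) : P.ps.le a c := by
  obtain ⟨x, hx⟩ := hab
  obtain ⟨y, hy⟩ := hbc
  obtain ⟨z, -, hz⟩ := assoc_right hx hy
  exact ⟨z, hz⟩

theorem le_one (P : PEA E) (a : E) : P.ps.le a P.one :=
  let ⟨d, hd, _⟩ := P.exu_right a
  ⟨d, hd⟩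

theorem le_padd_left {a b s : E} (h : P.padd a b = some s) : P.ps.le a s := ⟨b, h⟩

theorem le_padd_right {a b s : E} (h : P.padd a b = some s) : P.ps.le b s := (P.shift a b s h).2

theorem le_zero {a : E} (h : P.ps.le a P.zero) : a = P.zero := by
  obtain ⟨b, hb⟩ := h
  obtain ⟨x, hx, -⟩ := assoc_left hb P.one_add_zero
  exact P.one_add a x hx

theorem le_antisymm {a b : E} (hab : P.ps.le a b) (hba : P.ps.le b a) : a = b := by
  obtain ⟨x, hx⟩ := hab
  obtain ⟨y, hy⟩ := hba
  obtain ⟨z, hz, haz⟩ := assoc_right hx hy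
  obtain rfl := padd_left_cancel haz (P.padd_zero a)
  obtain rfl := le_zero (le_padd_left hz)
  exact Option.some.inj ((P.padd_zero a).symm.trans hx)

theorem isMeet_comm {a b m : E} (h : P.ps.IsMeet a b m) : P.ps.IsMeet b a m :=
  ⟨h.2.1, h.1, fun x hb ha => h.2.2 x ha hb⟩

theorem isMeet_unique {a b m n : E} (hm : P.ps.IsMeet a b m) (hn : P.ps.IsMeet a b n) : m = n :=
  le_antisymm (hn.2.2 m hm.1 hm.2.1) (hm.2.2 n hn.1 hn.2.1)

theorem isMeet_zero_iff {a b : E} :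
    P.ps.IsMeet a b P.zero ↔ ∀ x, P.ps.le x a → P.ps.le x b → x = P.zero :=
  ⟨fun h x ha hb => le_zero (h.2.2 x ha hb),
    fun h => ⟨P.zero_le a, P.zero_le b, fun x ha hb => h x ha hb ▸ P.le_refl _⟩⟩

theorem isMeet_zero_mono {a b a' b' : E} (h : P.ps.IsMeet a b P.zero) (ha : P.ps.le a' a)
    (hb : P.ps.le b' b) : P.ps.IsMeet a' b' P.zero :=
  isMeet_zero_iff.2 fun x hxa hxb => isMeet_zero_iff.1 h x (le_trans hxa ha) (le_trans hxb hb)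

/-- A pair of complementary additive projections `p`, `q` that exhibits `c = p 1` as a direct
factor of `P`. -/
structure IsDecomp (P : PEA E) (c : E) (p q : E → E) : Prop where
  map_one : p P.one = c
  sum : ∀ x, P.padd (p x) (q x) = some x
  left_add : ∀ {a b ab}, P.padd a b = some ab → P.padd (p a) (p b) = some (p ab)
  right_add : ∀ {a b ab}, P.padd a b = some ab → P.padd (q a) (q b) = some (q ab)
  right_left : ∀ x, q (p x) = P.zero
  left_right : ∀ x, p (q x) = P.zero
  exists_add : ∀ {a b s t}, P.padd (p a) (p b) = some s → P.padd (q a) (q b) = some t →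
    ∃ ab, P.padd a b = some ab

namespace IsDecomp

variable {c d : E} {p q p' q' : E → E}

theorem left_mono (h : P.IsDecomp c p q) {a b : E} (hab : P.ps.le a b) : P.ps.le (p a) (p b) :=
  let ⟨x, hx⟩ := hab
  ⟨p x, h.left_add hx⟩

theorem right_mono (h : P.IsDecomp c p q) {a b : E} (hab : P.ps.le a b) : P.ps.le (q a) (q b) :=
  let ⟨x, hx⟩ := hab
  ⟨q x, h.right_add hx⟩

theorem left_le_self (h : P.IsDecomp c p q) (x : E) : P.ps.le (p x) x := le_padd_left (h.sum x)

theorem left_le (h : P.IsDecomp c p q) (x : E) : P.ps.le (p x) c :=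
  h.map_one ▸ h.left_mono (P.le_one x)

theorem ext (h : P.IsDecomp c p q) {a b : E} (hp : p a = p b) (hq : q a = q b) : a = b :=
  Option.some.inj ((h.sum a).symm.trans ((congrArg₂ P.padd hp hq).trans (h.sum b)))

theorem left_idem (h : P.IsDecomp c p q) (x : E) : p (p x) = p x := by
  have := h.left_add (h.sum x)
  rw [h.left_right, P.padd_zero] at this
  exact Option.some.inj this

theorem right_idem (h : P.IsDecomp c p q) (x : E) : q (q x) = q x := by
  have := h.right_add (h.sum x)
  rw [h.right_left, P.zero_padd] at this
  exact Option.some.inj this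

theorem right_eq_zero (h : P.IsDecomp c p q) {x : E} (hx : P.ps.le x c) : q x = P.zero := by
  have := h.right_mono hx
  rw [← h.map_one, h.right_left] at this
  exact le_zero this

theorem left_eq_self (h : P.IsDecomp c p q) {x : E} (hx : P.ps.le x c) : p x = x := by
  have := h.sum x
  rw [h.right_eq_zero hx, P.padd_zero] at this
  exact Option.some.inj this

theorem left_eq_zero (h : P.IsDecomp c p q) {x : E} (hx : P.ps.le x (q P.one)) :
    p x = P.zero := by
  have := h.left_mono hx
  rw [h.left_right] at this
  exact le_zero this

theorem right_eq_self (h : P.IsDecomp c p q) {x : E} (hx : P.ps.le x (q P.one)) : q x = x := by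
  have := h.sum x
  rw [h.left_eq_zero hx, P.zero_padd] at this
  exact Option.some.inj this

theorem le_left (h : P.IsDecomp c p q) {x y : E} (hc : P.ps.le x c) (hy : P.ps.le x y) :
    P.ps.le x (p y) :=
  h.left_eq_self hc ▸ h.left_mono hy

theorem isMeet (h : P.IsDecomp c p q) (x : E) : P.ps.IsMeet x c (p x) :=
  ⟨h.left_le_self x, h.left_le x, fun _ hx hc => h.le_left hc hx⟩

theorem exists_pair (h : P.IsDecomp c p q) {a b : E} (ha : P.ps.le a c)
    (hb : P.ps.le b (q P.one)) : ∃ x, p x = a ∧ q x = b := by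
  have hp : P.padd (p a) (p b) = some a := by
    rw [h.left_eq_self ha, h.left_eq_zero hb, P.padd_zero]
  have hq : P.padd (q a) (q b) = some b := by
    rw [h.right_eq_zero ha, h.right_eq_self hb, P.zero_padd]
  obtain ⟨x, hx⟩ := h.exists_add hp hq
  exact ⟨x, Option.some.inj ((h.left_add hx).symm.trans hp),
    Option.some.inj ((h.right_add hx).symm.trans hq)⟩

theorem le_of_le (h : P.IsDecomp c p q) {a b : E} (hp : P.ps.le (p a) (p b))
    (hq : P.ps.le (q a) (q b)) : P.ps.le a b := by
  obtain ⟨u, hu⟩ := hp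
  obtain ⟨v, hv⟩ := hq
  obtain ⟨z, hzp, hzq⟩ := h.exists_pair (le_trans (le_padd_right hu) (h.left_le b))
    (le_trans (le_padd_right hv) (h.right_mono (P.le_one b)))
  rw [← hzp] at hu
  rw [← hzq] at hv
  obtain ⟨w, hw⟩ := h.exists_add hu hv
  obtain rfl := h.ext (Option.some.inj ((h.left_add hw).symm.trans hu))
    (Option.some.inj ((h.right_add hw).symm.trans hv))
  exact ⟨z, hw⟩

theorem isCentral (h : P.IsDecomp c p q) : P.ps.IsCentral c := by
  refine ⟨q P.one, ?_, fun x => (p x, q x), fun x => ⟨h.left_le x, h.right_mono (P.le_one x)⟩,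
    fun a b hab => h.ext (congrArg Prod.fst hab) (congrArg Prod.snd hab), ?_, ?_, ?_, h.sum,
    fun a b ab hab => ⟨h.left_add hab, h.right_add hab⟩,
    fun a b s t hs _ ht _ => h.exists_add hs ht⟩
  · simpa only [h.map_one] using h.sum P.one
  · rintro ⟨a, b⟩ ha hb
    obtain ⟨x, rfl, rfl⟩ := h.exists_pair ha hb
    exact ⟨x, rfl⟩
  · exact Prod.ext (h.left_eq_self (P.le_refl c)) (h.right_eq_zero (P.le_refl c))
  · exact Prod.ext h.map_one rfl

theorem refl (P : PEA E) : P.IsDecomp P.one id fun _ => P.zero where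
  map_one := rfl
  sum := P.padd_zero
  left_add h := h
  right_add _ := P.padd_zero _
  right_left _ := rfl
  left_right _ := rfl
  exists_add h _ := ⟨_, h⟩

theorem exists_inter (h : P.IsDecomp c p q) (h' : P.IsDecomp d p' q') :
    ∃ r, P.IsDecomp (p' c) (p' ∘ p) r := by
  have hp (x : E) : p (p' (p x)) = p' (p x) :=
    h.left_eq_self (le_trans (h'.left_le_self _) (h.left_le x))
  have hr (x : E) : ∃ r, P.padd (q' (p x)) (q x) = some r ∧ P.padd (p' (p x)) r = some x :=
    assoc_right (h'.sum (p x)) (h.sum x)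
  choose r hr₁ hr₂ using hr
  have hpq (x : E) : P.ps.le (q' (p x)) c :=
    le_trans (le_padd_right (h'.sum (p x))) (h.left_le x)
  have hpr (x : E) : p (r x) = q' (p x) := by
    have := h.left_add (hr₁ x)
    rw [h.left_right, P.padd_zero, h.left_eq_self (hpq x)] at this
    exact (Option.some.inj this).symm
  have hqr (x : E) : q (r x) = q x := by
    have := h.right_add (hr₁ x)
    rw [h.right_eq_zero (hpq x), P.zero_padd, h.right_idem] at this
    exact (Option.some.inj this).symm
  refine ⟨r, congrArg p' h.map_one, hr₂, fun hab => h'.left_add (h.left_add hab), ?_, ?_, ?_, ?_⟩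
  · intro a b ab hab
    have h₁ : P.padd (p (r a)) (p (r b)) = some (p (r ab)) := by
      simpa only [hpr] using h'.right_add (h.left_add hab)
    have h₂ : P.padd (q (r a)) (q (r b)) = some (q (r ab)) := by
      simpa only [hqr] using h.right_add hab
    obtain ⟨z, hz⟩ := h.exists_add h₁ h₂
    rw [hz, h.ext (Option.some.inj ((h.left_add hz).symm.trans h₁))
      (Option.some.inj ((h.right_add hz).symm.trans h₂))]
  · intro x
    refine h.ext ?_ ?_
    · rw [hpr, Function.comp_apply, hp, h'.right_left, h.left_eq_self (P.zero_le c)]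
    · rw [hqr, Function.comp_apply, ← hp, h.right_left, h.right_eq_zero (P.zero_le c)]
  · intro x
    rw [Function.comp_apply, hpr, h'.left_right]
  · intro a b s t hs ht
    have h₁ := h.left_add ht
    have h₂ := h.right_add ht
    rw [hpr, hpr] at h₁
    rw [hqr, hqr] at h₂
    obtain ⟨u, hu⟩ := h'.exists_add hs h₁
    exact h.exists_add hu h₂

/-- The projection onto a direct factor preserves suprema. -/
theorem isSup_image (h : P.IsDecomp c p q) {S : Set E} {s : E} (hs : P.ps.IsSup S s) :
    P.ps.IsSup (p '' S) (p s) := by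
  refine ⟨?_, fun u hu => ?_⟩
  · rintro _ ⟨x, hx, rfl⟩
    exact h.left_mono (hs.1 x hx)
  · obtain ⟨v, hv₁, hv₂⟩ := h.exists_pair (h.left_le u) (h.right_mono (P.le_one s))
    have hsv : P.ps.le s v := hs.2 v fun x hx => h.le_of_le
      (hv₁ ▸ h.le_left (h.left_le x) (hu _ ⟨x, hx, rfl⟩)) (hv₂ ▸ h.right_mono (hs.1 x hx))
    exact le_trans (hv₁ ▸ h.left_mono hsv) (h.left_le_self u)

end IsDecomp

theorem exists_isDecomp {c : E} (hc : P.ps.IsCentral c) : ∃ p q, P.IsDecomp c p q := by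
  obtain ⟨cs, hcs, f, hle, -, -, hfc, hf1, hsum, hadd, hex⟩ := hc
  have hfcs : f cs = (P.zero, cs) := by
    have := hadd c cs P.one hcs
    rw [hfc, hf1] at this
    exact Prod.ext (padd_left_cancel this.1 (P.padd_zero c))
      (padd_left_cancel this.2 (P.zero_padd cs))
  have hright {x : E} (hx : P.ps.le x c) : (f x).2 = P.zero := by
    obtain ⟨y, hy⟩ := hx
    have := (hadd _ _ _ hy).2
    rw [hfc] at this
    exact le_zero (le_padd_left this)
  have hleft {x : E} (hx : P.ps.le x cs) : (f x).1 = P.zero := by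
    obtain ⟨y, hy⟩ := hx
    have := (hadd _ _ _ hy).1
    rw [hfcs] at this
    exact le_zero (le_padd_left this)
  refine ⟨fun x => (f x).1, fun x => (f x).2, congrArg Prod.fst hf1, hsum,
    fun h => (hadd _ _ _ h).1, fun h => (hadd _ _ _ h).2, fun x => hright (hle x).1,
    fun x => hleft (hle x).2, fun {a b s t} hs ht => hex a b s t hs ?_ ht ?_⟩
  · have h₁ := (hadd _ _ _ hs).2
    rw [hright (hle a).1, hright (hle b).1, P.padd_zero] at h₁
    have h₂ := hsum s
    rw [← Option.some.inj h₁, P.padd_zero] at h₂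
    exact Option.some.inj h₂ ▸ (hle s).1
  · have h₁ := (hadd _ _ _ ht).1
    rw [hleft (hle a).2, hleft (hle b).2, P.padd_zero] at h₁
    have h₂ := hsum t
    rw [← Option.some.inj h₁, P.zero_padd] at h₂
    exact Option.some.inj h₂ ▸ (hle t).2

theorem isCentral_one (P : PEA E) : P.ps.IsCentral P.one := (IsDecomp.refl P).isCentral

theorem exists_isCentral_isMeet {c d : E} (hc : P.ps.IsCentral c) (hd : P.ps.IsCentral d) :
    ∃ m, P.ps.IsCentral m ∧ P.ps.IsMeet c d m := by
  obtain ⟨p, q, h⟩ := exists_isDecomp hc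
  obtain ⟨p', q', h'⟩ := exists_isDecomp hd
  obtain ⟨r, hr⟩ := h.exists_inter h'
  exact ⟨p' c, hr.isCentral, h'.isMeet c⟩

theorem isMeet_self_one (P : PEA E) (x : E) : P.ps.IsMeet x P.one x :=
  ⟨P.le_refl x, P.le_one x, fun _ h _ => h⟩

theorem isSup_range_comp {I : Type} {c s : E} {p q : E → E} (h : P.IsDecomp c p q) {e : I → E}
    (hs : P.ps.IsSup (Set.range e) s) : P.ps.IsSup (Set.range fun i => p (e i)) (p s) := by
  have := h.isSup_image hs
  rwa [← Set.range_comp] at this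

/-- The components of the supremum of a Γ-orthogonal family are the members of the family. -/
theorem proj_isSup {I : Type} {e c : I → E} {p q : I → E → E} {s : E}
    (h : ∀ i, P.IsDecomp (c i) (p i) (q i))
    (hdis : ∀ i j, i ≠ j → P.ps.IsMeet (c i) (c j) P.zero) (hle : ∀ i, P.ps.le (e i) (c i))
    (hs : P.ps.IsSup (Set.range e) s) (i : I) : p i s = e i := by
  refine le_antisymm ((isSup_range_comp (h i) hs).2 _ ?_) ((h i).le_left (hle i) (hs.1 _ ⟨i, rfl⟩))
  rintro _ ⟨j, rfl⟩
  change P.ps.le (p i (e j)) (e i)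
  by_cases hij : i = j
  · subst hij
    exact (h i).left_le_self _
  · have := isMeet_zero_iff.1 (hdis i j hij) (p i (e j)) ((h i).left_le _)
      (le_trans ((h i).left_le_self _) (hle j))
    exact this.symm ▸ P.zero_le (e i)

/-- In a centrally orthocomplete algebra, every element below the supremum of a Γ-orthogonal
family is the supremum of its components. -/
theorem isSup_proj_of_le (hco : P.ps.IsCOPEA) {I : Type} {e c : I → E} {p q : I → E → E} {s x : E}
    (h : ∀ i, P.IsDecomp (c i) (p i) (q i))
    (hdis : ∀ i j, i ≠ j → P.ps.IsMeet (c i) (c j) P.zero) (hle : ∀ i, P.ps.le (e i) (c i))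
    (hs : P.ps.IsSup (Set.range e) s) (hx : P.ps.le x s) :
    P.ps.IsSup (Set.range fun i => p i x) x := by
  obtain ⟨y, hy⟩ := hco I (fun i => p i x)
    ⟨c, fun i => (h i).isCentral, hdis, fun i => (h i).left_le x⟩
  have hyx : P.ps.le y x := hy.2 x (by rintro _ ⟨i, rfl⟩; exact (h i).left_le_self x)
  obtain ⟨z, hz⟩ := hyx
  have hpz (i : I) : p i z = P.zero := by
    have := (h i).left_add hz
    rw [proj_isSup h hdis (fun i => (h i).left_le x) hy i] at this
    exact padd_left_cancel this (P.padd_zero _)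
  obtain ⟨w, hw⟩ := (P.shift z _ s (le_trans (le_padd_right hz) hx).choose_spec).1
  have hsw : P.ps.le s w := by
    refine hs.2 w ?_
    rintro _ ⟨i, rfl⟩
    have := (h i).left_add hw
    rw [hpz, P.padd_zero, proj_isSup h hdis hle hs i] at this
    exact Option.some.inj this ▸ (h i).left_le_self w
  obtain rfl := le_antisymm hsw (le_padd_left hw)
  obtain rfl := padd_left_cancel hw (P.padd_zero s)
  obtain rfl := Option.some.inj ((P.padd_zero y).symm.trans hz)
  exact hy

theorem bra_mono {K L : Set E} (h : K ⊆ L) : P.ps.bra K ⊆ P.ps.bra L :=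
  fun _ ⟨I, e, he, ho, hs⟩ => ⟨I, e, fun i => h (he i), ho, hs⟩

theorem subset_bra (P : PEA E) (K : Set E) : K ⊆ P.ps.bra K := by
  intro x hx
  refine ⟨Unit, fun _ => x, fun _ => hx, ⟨fun _ => P.one, fun _ => P.isCentral_one,
    fun i j hij => (hij rfl).elim, fun _ => P.le_one x⟩, ?_, fun u hu => hu x ⟨(), rfl⟩⟩
  rintro _ ⟨-, rfl⟩
  exact P.le_refl x

theorem bra_bra (P : PEA E) (K : Set E) : P.ps.bra (P.ps.bra K) = P.ps.bra K := by
  refine Set.Subset.antisymm ?_ (P.subset_bra _)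
  rintro s ⟨I, t, ht, ⟨c, hc, hdis, hle⟩, hs⟩
  choose J e heK ho hsup using ht
  choose d hd hdis' hle' using ho
  choose m hm hmeet using fun k : Σ i, J i => exists_isCentral_isMeet (hc k.1) (hd k.1 k.2)
  refine ⟨Σ i, J i, fun k => e k.1 k.2, fun k => heK _ _, ⟨m, hm, ?_, fun k =>
    (hmeet k).2.2 _ (le_trans ((hsup k.1).1 _ ⟨k.2, rfl⟩) (hle k.1)) (hle' _ _)⟩, ?_, ?_⟩
  · rintro ⟨i, j⟩ ⟨i', j'⟩ hne
    by_cases hi : i = i'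
    · subst hi
      exact isMeet_zero_mono (hdis' i j j' fun hj => hne (hj ▸ rfl)) (hmeet _).2.1 (hmeet _).2.1
    · exact isMeet_zero_mono (hdis i i' hi) (hmeet _).1 (hmeet _).1
  · rintro _ ⟨k, rfl⟩
    exact le_trans ((hsup k.1).1 _ ⟨k.2, rfl⟩) (hs.1 _ ⟨k.1, rfl⟩)
  · refine fun u hu => hs.2 u ?_
    rintro _ ⟨i, rfl⟩
    refine (hsup i).2 u ?_
    rintro _ ⟨j, rfl⟩
    exact hu _ ⟨⟨i, j⟩, rfl⟩

theorem gammaClosure_mono {K L : Set E} (h : K ⊆ L) :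
    P.ps.gammaClosure K ⊆ P.ps.gammaClosure L :=
  fun _ ⟨q, hq, hm⟩ => ⟨q, h hq, hm⟩

theorem subset_gammaClosure (P : PEA E) (K : Set E) : K ⊆ P.ps.gammaClosure K :=
  fun x hx => ⟨x, hx, P.one, P.isCentral_one, P.isMeet_self_one x⟩

theorem gammaClosure_gammaClosure_subset (P : PEA E) (K : Set E) :
    P.ps.gammaClosure (P.ps.gammaClosure K) ⊆ P.ps.gammaClosure K := by
  rintro m ⟨n, ⟨q, hq, c, hc, hn⟩, d, hd, hm⟩
  obtain ⟨b, hb, hbm⟩ := exists_isCentral_isMeet hc hd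
  refine ⟨q, hq, b, hb, le_trans hm.1 hn.1, hbm.2.2 _ (le_trans hm.1 hn.2.1) hm.2.1,
    fun x hxq hxb => hm.2.2 x (hn.2.2 x hxq (le_trans hxb hbm.1)) (le_trans hxb hbm.2.1)⟩

theorem isTD_bra {K : Set E} (hK : P.ps.gammaClosure K ⊆ K) : P.ps.IsTD (P.ps.bra K) := by
  refine ⟨P.bra_bra K, Set.Subset.antisymm ?_ (P.subset_gammaClosure _)⟩
  rintro m ⟨s, ⟨I, e, he, ⟨c, hc, hdis, hle⟩, hs⟩, d, hd, hm⟩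
  obtain ⟨p, q, h⟩ := exists_isDecomp hd
  obtain rfl := isMeet_unique hm (h.isMeet s)
  exact ⟨I, fun i => p (e i), fun i => hK ⟨e i, he i, d, hd, h.isMeet _⟩,
    ⟨c, hc, hdis, fun i => le_trans (h.left_le_self _) (hle i)⟩, isSup_range_comp h hs⟩

theorem downSet_mono {K L : Set E} (h : K ⊆ L) : P.ps.downSet K ⊆ P.ps.downSet L :=
  fun _ ⟨q, hq, hm⟩ => ⟨q, h hq, hm⟩

theorem subset_downSet (P : PEA E) (K : Set E) : K ⊆ P.ps.downSet K :=
  fun x hx => ⟨x, hx, P.le_refl x⟩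

theorem downSet_downSet_subset (P : PEA E) (K : Set E) :
    P.ps.downSet (P.ps.downSet K) ⊆ P.ps.downSet K :=
  fun _ ⟨_, ⟨q, hq, hxq⟩, hx⟩ => ⟨q, hq, le_trans hx hxq⟩

theorem gammaClosure_subset_downSet (P : PEA E) (K : Set E) :
    P.ps.gammaClosure K ⊆ P.ps.downSet K :=
  fun _ ⟨q, hq, _, _, hm⟩ => ⟨q, hq, hm.1⟩

theorem isSTD_bra (hco : P.ps.IsCOPEA) {K : Set E} (hK : P.ps.downSet K ⊆ K) :
    P.ps.IsSTD (P.ps.bra K) := by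
  refine ⟨P.bra_bra K, Set.Subset.antisymm ?_ (P.subset_downSet _)⟩
  rintro x ⟨s, ⟨I, e, he, ⟨c, hc, hdis, hle⟩, hs⟩, hx⟩
  choose p q h using fun i => exists_isDecomp (hc i)
  exact ⟨I, fun i => p i x,
    fun i => hK ⟨e i, he i, proj_isSup h hdis hle hs i ▸ (h i).left_mono hx⟩,
    ⟨c, hc, hdis, fun i => (h i).left_le x⟩, isSup_proj_of_le hco h hdis hle hs hx⟩

theorem commutant_anti {K L : Set E} (h : K ⊆ L) : P.ps.commutant L ⊆ P.ps.commutant K :=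
  fun _ he q hq => he q (h hq)

theorem subset_commutant_commutant (P : PEA E) (K : Set E) :
    K ⊆ P.ps.commutant (P.ps.commutant K) :=
  fun _ hx _ he => isMeet_comm (he _ hx)

theorem isSTD_commutant (hco : P.ps.IsCOPEA) (K : Set E) : P.ps.IsSTD (P.ps.commutant K) := by
  refine ⟨Set.Subset.antisymm ?_ (P.subset_bra _), Set.Subset.antisymm ?_ (P.subset_downSet _)⟩
  · rintro s ⟨I, e, he, ⟨c, hc, hdis, hle⟩, hs⟩ k hk
    refine isMeet_zero_iff.2 fun x hxk hxs => ?_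
    choose p q h using fun i => exists_isDecomp (hc i)
    refine le_zero ((isSup_proj_of_le hco h hdis hle hs hxs).2 P.zero ?_)
    rintro _ ⟨i, rfl⟩
    have := isMeet_zero_iff.1 (he i k hk) (p i x) (le_trans ((h i).left_le_self x) hxk)
      (proj_isSup h hdis hle hs i ▸ (h i).left_mono hxs)
    exact this ▸ P.le_refl _
  · rintro x ⟨e, he, hx⟩ k hk
    exact isMeet_zero_mono (he k hk) (P.le_refl k) hx

theorem bra_gammaClosure_subset {K L : Set E} (hL : P.ps.IsTD L) (h : K ⊆ L) :
    P.ps.bra (P.ps.gammaClosure K) ⊆ L := by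
  have := bra_mono (P := P) (gammaClosure_mono (P := P) h)
  rwa [hL.2, hL.1] at this

theorem bra_downSet_subset {K L : Set E} (hL : P.ps.IsSTD L) (h : K ⊆ L) :
    P.ps.bra (P.ps.downSet K) ⊆ L := by
  have := bra_mono (P := P) (downSet_mono (P := P) h)
  rwa [hL.2, hL.1] at this

theorem commutant_eq_of_subset {K L : Set E} (h : K ⊆ L)
    (h' : L ⊆ P.ps.commutant (P.ps.commutant K)) : P.ps.commutant K = P.ps.commutant L :=
  Set.Subset.antisymm ((P.subset_commutant_commutant _).trans (commutant_anti h'))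
    (commutant_anti h)

end PEA

end PEApaper

open PEApaper PEApaper.PartialStruct in
/-- Theorem 5.2: in a COPEA, for `Q ⊆ E`:
(i) `[Q^γ]` is the smallest TD set containing `Q`;
(ii) `[Q↓]` is the smallest STD set containing `Q`;
(iii) `Q'` and `Q''` are STD;
(iv) `Q' = [Q^γ]' = [Q↓]'`. -/
theorem stmt12 {E : Type} (P : PEA E) (hco : P.ps.IsCOPEA) (Q : Set E) :
    (P.ps.IsTD (P.ps.bra (P.ps.gammaClosure Q)) ∧
      Q ⊆ P.ps.bra (P.ps.gammaClosure Q) ∧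
      ∀ K, P.ps.IsTD K → Q ⊆ K → P.ps.bra (P.ps.gammaClosure Q) ⊆ K) ∧
    (P.ps.IsSTD (P.ps.bra (P.ps.downSet Q)) ∧
      Q ⊆ P.ps.bra (P.ps.downSet Q) ∧
      ∀ K, P.ps.IsSTD K → Q ⊆ K → P.ps.bra (P.ps.downSet Q) ⊆ K) ∧
    (P.ps.IsSTD (P.ps.commutant Q) ∧
      P.ps.IsSTD (P.ps.commutant (P.ps.commutant Q))) ∧
    (P.ps.commutant Q = P.ps.commutant (P.ps.bra (P.ps.gammaClosure Q)) ∧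
      P.ps.commutant Q = P.ps.commutant (P.ps.bra (P.ps.downSet Q))) := by
  have hγ : Q ⊆ P.ps.bra (P.ps.gammaClosure Q) :=
    (P.subset_gammaClosure Q).trans (P.subset_bra _)
  have hd : Q ⊆ P.ps.bra (P.ps.downSet Q) := (P.subset_downSet Q).trans (P.subset_bra _)
  have hQ : P.ps.bra (P.ps.downSet Q) ⊆ P.ps.commutant (P.ps.commutant Q) :=
    PEA.bra_downSet_subset (PEA.isSTD_commutant hco _) (P.subset_commutant_commutant Q)
  exact ⟨⟨PEA.isTD_bra (P.gammaClosure_gammaClosure_subset Q), hγ,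
      fun _ => PEA.bra_gammaClosure_subset⟩,
    ⟨PEA.isSTD_bra hco (P.downSet_downSet_subset Q), hd, fun _ => PEA.bra_downSet_subset⟩,
    ⟨PEA.isSTD_commutant hco _, PEA.isSTD_commutant hco _⟩,
    PEA.commutant_eq_of_subset hγ ((PEA.bra_mono (P.gammaClosure_subset_downSet Q)).trans hQ),
    PEA.commutant_eq_of_subset hd hQ⟩
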